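/- Let Q=(0,1)² and fix a constant M>2. For every n ∈ ℕ with n ≥ 1, the set A_n := {f ∈ X : there exists E ⊆ Q, a finite union of pairwise disjoint open triangles, with |E| < 1/n and |f(E)| > 1 − 1/n} is open in the metric space (X,d). -/

import Mathlib

open MeasureTheory Set
open scoped ENNReal

noncomputable section

abbrev Plane := EuclideanSpace ℝ (Fin 2)

/-- The open unit square `(0,1)²`. -/
def unitSq : Set Plane := {x | 0 < x 0 ∧ x 0 < 1 ∧ 0 < x 1 ∧ x 1 < 1}

/-- Standard basis vectors of the plane. -/
def e2 (i : Fin 2) : Plane := EuclideanSpace.single i 1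

/-- The set of approximating values in the definition of the variation of `f` on `U`:
integrals against `C¹_c` test fields `φ = (φ₁, φ₂)` all of whose four components are
bounded by `1` in absolute value. -/
def varSet (f : Plane → Plane) (U : Set Plane) : Set ℝ :=
  {v | ∃ φ : Plane → Plane × Plane,
    ContDiff ℝ 1 φ ∧ HasCompactSupport φ ∧ tsupport φ ⊆ U ∧
    (∀ x i, |(φ x).1 i| ≤ 1 ∧ |(φ x).2 i| ≤ 1) ∧
    v = ∫ x in U, ((f x 0) * (fderiv ℝ (fun y => (φ y).1 0) x (e2 0)
                    + fderiv ℝ (fun y => (φ y).1 1) x (e2 1))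
        + (f x 1) * (fderiv ℝ (fun y => (φ y).2 0) x (e2 0)
                    + fderiv ℝ (fun y => (φ y).2 1) x (e2 1)))}

/-- The variation of `f` in `U`. -/
def Var (f : Plane → Plane) (U : Set Plane) : ℝ := sSup (varSet f U)

/-- `f` is a `BV` map on `U`. -/
def IsBV (f : Plane → Plane) (U : Set Plane) : Prop :=
  IntegrableOn f U volume ∧ BddAbove (varSet f U)

/-- `f` is a homeomorphism of `U` onto `V`, with inverse `g`. -/
def IsHomeoOn (f g : Plane → Plane) (U V : Set Plane) : Prop :=
  BijOn f U V ∧ ContinuousOn f U ∧ InvOn g f U V ∧ ContinuousOn g V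

/-- `f` (as a total function, representing its own continuous extension) extends
continuously to the closure of the unit square, with `f = Id` on the boundary. -/
def ExtendsToId (f : Plane → Plane) : Prop :=
  ContinuousOn f (closure unitSq) ∧ EqOn f id (frontier unitSq)

/-- The space `X` of `BV` homeomorphisms of the unit square fixing the boundary with
variation smaller than `M`; an element is a pair (homeomorphism, inverse). -/
def X (M : ℝ) : Set ((Plane → Plane) × (Plane → Plane)) :=
  {p | IsHomeoOn p.1 p.2 unitSq unitSq ∧ ExtendsToId p.1 ∧
    IsBV p.1 unitSq ∧ Var p.1 unitSq < M}

/-- Sup distance `‖f - g‖_∞` over the set `U`. -/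
def supDist (f g : Plane → Plane) (U : Set Plane) : ℝ := ⨆ x : U, dist (f x) (g x)

/-- The distance `d` on `X`. -/
def dX (M : ℝ) (p q : (Plane → Plane) × (Plane → Plane)) : ℝ :=
  supDist p.1 q.1 unitSq + supDist p.2 q.2 unitSq +
    |1 / (M - Var p.1 unitSq) - 1 / (M - Var q.1 unitSq)|

/-- `A` is open in the metric space `(X, d)`. -/
def OpenInX (M : ℝ) (A : Set ((Plane → Plane) × (Plane → Plane))) : Prop :=
  A ⊆ X M ∧ ∀ p ∈ A, ∃ ε > 0, ∀ q ∈ X M, dX M p q < ε → q ∈ A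

/-- `A` is dense in the metric space `(X, d)`. -/
def DenseInX (M : ℝ) (A : Set ((Plane → Plane) × (Plane → Plane))) : Prop :=
  A ⊆ X M ∧ ∀ p ∈ X M, ∀ ε > 0, ∃ q ∈ A, dX M p q < ε

/-- An open triangle in the plane. -/
def IsOpenTriangle (T : Set Plane) : Prop :=
  ∃ a b c : Plane, T = interior (convexHull ℝ {a, b, c})

/-- A finite union of pairwise disjoint open triangles. -/
def FinUnionTriangles (E : Set Plane) : Prop :=
  ∃ (k : ℕ) (T : Fin k → Set Plane), (∀ i, IsOpenTriangle (T i)) ∧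
    (∀ i j, i ≠ j → Disjoint (T i) (T j)) ∧ E = ⋃ i, T i

/-- The set `A` of homeomorphisms mapping a null set onto a set of full measure. -/
def Afull (M : ℝ) : Set ((Plane → Plane) × (Plane → Plane)) :=
  {p ∈ X M | ∃ E ⊆ unitSq, volume E = 0 ∧ volume (p.1 '' E) = 1}

/-- The set `A_n`. -/
def An (M : ℝ) (n : ℕ) : Set ((Plane → Plane) × (Plane → Plane)) :=
  {p ∈ X M | ∃ E ⊆ unitSq, FinUnionTriangles E ∧
    volume E < 1 / (n : ℝ≥0∞) ∧ 1 - 1 / (n : ℝ≥0∞) < volume (p.1 '' E)}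

theorem isOpen_unitSq : IsOpen unitSq := by
  have h0 : Continuous fun x : Plane => x 0 := by fun_prop
  have h1 : Continuous fun x : Plane => x 1 := by fun_prop
  exact (isOpen_lt continuous_const h0).inter <| (isOpen_lt h0 continuous_const).inter <|
    (isOpen_lt continuous_const h1).inter (isOpen_lt h1 continuous_const)

theorem dist_le_two_of_mem_unitSq {x y : Plane} (hx : x ∈ unitSq) (hy : y ∈ unitSq) :
    dist x y ≤ 2 := by
  obtain ⟨h1, h2, h3, h4⟩ := hx
  obtain ⟨k1, k2, k3, k4⟩ := hy
  rw [EuclideanSpace.dist_eq, Real.sqrt_le_left (by norm_num), Fin.sum_univ_two,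
    Real.dist_eq, Real.dist_eq, sq_abs, sq_abs]
  nlinarith

theorem FinUnionTriangles.isOpen {E : Set Plane} (hE : FinUnionTriangles E) : IsOpen E := by
  obtain ⟨k, T, hT, -, rfl⟩ := hE
  refine isOpen_iUnion fun i => ?_
  obtain ⟨a, b, c, h⟩ := hT i
  exact h ▸ isOpen_interior

theorem supDist_nonneg (f g : Plane → Plane) (U : Set Plane) : 0 ≤ supDist f g U :=
  Real.iSup_nonneg fun _ => dist_nonneg

theorem dist_le_supDist {f g : Plane → Plane} {U : Set Plane} (hf : MapsTo f U unitSq)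
    (hg : MapsTo g U unitSq) {x : Plane} (hx : x ∈ U) : dist (f x) (g x) ≤ supDist f g U :=
  le_ciSup (f := fun x : U => dist (f x) (g x))
    ⟨2, by rintro _ ⟨y, rfl⟩; exact dist_le_two_of_mem_unitSq (hf y.2) (hg y.2)⟩ ⟨x, hx⟩

theorem IsHomeoOn.mapsTo_inverse {f g : Plane → Plane} {U V : Set Plane}
    (h : IsHomeoOn f g U V) : MapsTo g V U := by
  intro y hy
  obtain ⟨x, hx, rfl⟩ := h.1.surjOn hy
  rwa [h.2.2.1.1 hx]

theorem IsHomeoOn.image_eq {f g : Plane → Plane} {U V E : Set Plane}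
    (h : IsHomeoOn f g U V) (hE : E ⊆ U) : f '' E = V ∩ g ⁻¹' E := by
  ext y
  constructor
  · rintro ⟨x, hx, rfl⟩
    refine ⟨h.1.mapsTo (hE hx), ?_⟩
    rwa [mem_preimage, h.2.2.1.1 (hE hx)]
  · rintro ⟨hy, hgy⟩
    exact ⟨g y, hgy, h.2.2.1.2 hy⟩

/-- for every `n ≥ 1`, the set `A_n` is open in the metric space `(X, d)`. -/
theorem An_open (M : ℝ) (hM : 2 < M) (n : ℕ) (hn : 1 ≤ n) :
    OpenInX M (An M n) := by
  refine ⟨fun p hp => hp.1, ?_⟩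
  rintro p ⟨hpX, E, hEQ, hET, hE, hpE⟩
  have hp := hpX.1
  have hopen : IsOpen (p.1 '' E) := by
    rw [hp.image_eq hEQ]
    exact hp.2.2.2.isOpen_inter_preimage isOpen_unitSq hET.isOpen
  obtain ⟨K, hKE, hK, hKn⟩ := hopen.exists_lt_isCompact hpE
  rw [hp.image_eq hEQ] at hKE
  obtain ⟨δ, hδ, hδE⟩ := (hK.image_of_continuousOn
    (hp.2.2.2.mono fun y hy => (hKE hy).1)).exists_thickening_subset_open hET.isOpen
    (image_subset_iff.2 fun y hy => (hKE hy).2)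
  refine ⟨δ, hδ, fun q hq hpq => ⟨hq, E, hEQ, hET, hE, hKn.trans_le (measure_mono ?_)⟩⟩
  rw [hq.1.image_eq hEQ]
  intro y hy
  refine ⟨(hKE hy).1, hδE (Metric.mem_thickening_iff.2 ⟨p.2 y, mem_image_of_mem _ hy, ?_⟩)⟩
  rw [dist_comm]
  have hle := dist_le_supDist hp.mapsTo_inverse hq.1.mapsTo_inverse (hKE hy).1
  have hnonneg := supDist_nonneg p.1 q.1 unitSq
  have habs := abs_nonneg (1 / (M - Var p.1 unitSq) - 1 / (M - Var q.1 unitSq))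
  unfold dX at hpq
  linarith

end
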